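/- Let K be a finite connected simple graph with V vertices and E edges, and set q = E - V + 1. Then the number of symmetric cellular 2-cycles in K² equals 2^{q(q+1)/2}. -/

import Mathlib

/-- A 1-cycle in a simple graph `G` is a set `C` of edges of `G` such that every
vertex is incident to an even number of edges of `C`. -/
def IsOneCycle {V : Type*} [DecidableEq V] (G : SimpleGraph V) (C : Finset (Sym2 V)) : Prop :=
  (∀ e ∈ C, e ∈ G.edgeSet) ∧ ∀ v : V, Even (C.filter (fun e => v ∈ e)).card

/-- A cellular 2-cycle in `K²` is a set `C` of ordered pairs of edges of `K` such that
for every edge `σ`, both sections `{τ : (σ,τ) ∈ C}` and `{τ : (τ,σ) ∈ C}` are 1-cycles. -/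
def IsCellular2Cycle {V : Type*} [DecidableEq V] (G : SimpleGraph V)
    (C : Finset (Sym2 V × Sym2 V)) : Prop :=
  (∀ p ∈ C, p.1 ∈ G.edgeSet ∧ p.2 ∈ G.edgeSet) ∧
  ∀ σ : Sym2 V,
    IsOneCycle G ((C.filter (fun p => p.1 = σ)).image Prod.snd) ∧
    IsOneCycle G ((C.filter (fun p => p.2 = σ)).image Prod.fst)

/-- Symmetric matrices correspond to functions on unordered pairs of indices. -/
theorem Matrix.card_isSymm (n R : Type*) [Fintype n] [DecidableEq n] [Fintype R] :
    Nat.card {A : Matrix n n R // A.IsSymm} = Fintype.card R ^ (Fintype.card n + 1).choose 2 := by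
  have e : {A : Matrix n n R // A.IsSymm} ≃ (Sym2 n → R) :=
    (Equiv.subtypeEquivRight fun A : Matrix n n R =>
      ⟨fun h i j => h.apply j i, fun h => Matrix.IsSymm.ext fun i j => h j i⟩).trans Sym2.lift
  rw [Nat.card_congr e, Nat.card_eq_fintype_card, Fintype.card_fun, Sym2.card]

open Matrix in
/-- The number of symmetric matrices over a finite field whose columns all lie in a given
subspace. -/
theorem Matrix.card_isSymm_col_mem {n K : Type*} [Fintype n] [DecidableEq n] [Field K] [Fintype K]
    (Z : Submodule K (n → K)) :
    Nat.card {A : Matrix n n K // A.IsSymm ∧ ∀ j, A.col j ∈ Z} =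
      Fintype.card K ^ (Module.finrank K Z + 1).choose 2 := by
  let b := Module.finBasis K Z
  let f : (Fin (Module.finrank K Z) → K) →ₗ[K] (n → K) :=
    Z.subtype ∘ₗ (b.equivFun.symm : _ →ₗ[K] Z)
  have hf : LinearMap.ker f = ⊥ :=
    LinearMap.ker_eq_bot.2 (Z.injective_subtype.comp b.equivFun.symm.injective)
  obtain ⟨g, hg⟩ := f.exists_leftInverse_of_injective hf
  have hfZ (x) : f x ∈ Z := (b.equivFun.symm x).2
  have hfg (z) (hz : z ∈ Z) : f (g z) = z := by
    have h : f (b.equivFun ⟨z, hz⟩) = z := by simp [f]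
    rw [← h]
    exact congrArg f (LinearMap.congr_fun hg _)
  let B := LinearMap.toMatrix' f
  let L := LinearMap.toMatrix' g
  have hLB : L * B = 1 := by rw [← LinearMap.toMatrix'_comp, hg, LinearMap.toMatrix'_id]
  have hBL (A : Matrix n n K) (hA : ∀ j, A.col j ∈ Z) : B * (L * A) = A := by
    ext i j
    have h := congrFun (hfg _ (hA j)) i
    rw [← LinearMap.toMatrix'_mulVec f, ← LinearMap.toMatrix'_mulVec g] at h
    exact h
  have hBT (S : Matrix (Fin (Module.finrank K Z)) n K) (j) : (B * S).col j ∈ Z := by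
    have h := hfZ (S.col j)
    rw [← LinearMap.toMatrix'_mulVec f] at h
    exact h
  have hBLT (A : Matrix n n K) (hs : A.IsSymm) (hA : ∀ j, A.col j ∈ Z) : A * Lᵀ * Bᵀ = A := by
    have h := congrArg transpose (hBL A hA)
    rwa [transpose_mul, transpose_mul, hs.eq] at h
  have e : {A : Matrix n n K // A.IsSymm ∧ ∀ j, A.col j ∈ Z} ≃
      {S : Matrix (Fin (Module.finrank K Z)) (Fin (Module.finrank K Z)) K // S.IsSymm} :=
    { toFun A := ⟨L * A.1 * Lᵀ, by
        simp [Matrix.IsSymm, transpose_mul, A.2.1.eq, Matrix.mul_assoc]⟩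
      invFun S := ⟨B * S.1 * Bᵀ, by
        simp [Matrix.IsSymm, transpose_mul, S.2.eq, Matrix.mul_assoc], fun j => by
        rw [Matrix.mul_assoc]; exact hBT _ j⟩
      left_inv A := Subtype.ext <| by
        have h : B * (L * A.1 * Lᵀ) * Bᵀ = B * (L * (A.1 * Lᵀ * Bᵀ)) := by
          simp only [Matrix.mul_assoc]
        simp only [h, hBLT A.1 A.2.1 A.2.2, hBL A.1 A.2.2]
      right_inv S := Subtype.ext <| by
        have h : L * (B * S.1 * Bᵀ) * Lᵀ = (L * B) * S.1 * (L * B)ᵀ := by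
          simp only [Matrix.mul_assoc, transpose_mul]
        simp only [h, hLB, transpose_one, Matrix.one_mul, Matrix.mul_one] }
  rw [Nat.card_congr e, Matrix.card_isSymm, Fintype.card_fin]

namespace SimpleGraph

variable {V : Type*} [Fintype V] [DecidableEq V] (G : SimpleGraph V)

/-- The mod 2 boundary matrix of `G`, with columns indexed by the edges of `G`. -/
def boundaryMatrix : Matrix V G.edgeSet (ZMod 2) :=
  Matrix.of fun v e => if v ∈ e.1 then 1 else 0

/-- The mod 2 cycle space of `G`, as a space of functions supported on the edges. -/
def cycleSpace : Submodule (ZMod 2) (Sym2 V → ZMod 2) where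
  carrier := {x | (∀ e ∉ G.edgeSet, x e = 0) ∧ ∀ v, ∑ e with v ∈ e, x e = 0}
  add_mem' := by
    rintro x y ⟨hx, hx'⟩ ⟨hy, hy'⟩
    exact ⟨fun e he => by simp [hx e he, hy e he], fun v => by
      simp [Finset.sum_add_distrib, hx' v, hy' v]⟩
  zero_mem' := by simp
  smul_mem' := by
    rintro c x ⟨hx, hx'⟩
    exact ⟨fun e he => by simp [hx e he], fun v => by simp [← Finset.mul_sum, hx' v]⟩

variable {G}

theorem mem_cycleSpace {x : Sym2 V → ZMod 2} :
    x ∈ G.cycleSpace ↔ (∀ e ∉ G.edgeSet, x e = 0) ∧ ∀ v, ∑ e with v ∈ e, x e = 0 :=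
  Iff.rfl

theorem boundaryMatrix_mulVec_restrict [DecidableRel G.Adj] {x : Sym2 V → ZMod 2}
    (hx : ∀ e ∉ G.edgeSet, x e = 0) (v : V) :
    (G.boundaryMatrix.mulVec fun e => x e) v = ∑ e with v ∈ e, x e := by
  simp only [Matrix.mulVec, dotProduct, boundaryMatrix, Matrix.of_apply, ite_mul, one_mul,
    zero_mul]
  rw [Finset.sum_filter]
  refine (Finset.sum_congr_set G.edgeSet _ _ (fun _ _ => rfl) fun e he => ?_).symm
  simp [hx e he]

theorem finrank_cycleSpace_eq_finrank_ker [DecidableRel G.Adj] :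
    Module.finrank (ZMod 2) G.cycleSpace =
      Module.finrank (ZMod 2) (LinearMap.ker G.boundaryMatrix.mulVecLin) := by
  refine LinearEquiv.finrank_eq
    { toFun x := ⟨fun e => x.1 e, ?_⟩
      invFun y := ⟨fun e => if h : e ∈ G.edgeSet then y.1 ⟨e, h⟩ else 0, ?_⟩
      map_add' _ _ := rfl
      map_smul' _ _ := rfl
      left_inv x := ?_
      right_inv y := ?_ }
  · ext v
    exact (boundaryMatrix_mulVec_restrict x.2.1 v).trans (x.2.2 v)
  · have h0 : ∀ e ∉ G.edgeSet, (if h : e ∈ G.edgeSet then y.1 ⟨e, h⟩ else 0) = 0 :=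
      fun e he => dif_neg he
    refine ⟨h0, fun v => ?_⟩
    rw [← boundaryMatrix_mulVec_restrict h0]
    have h : G.boundaryMatrix.mulVec y.1 = 0 := y.2
    simpa using congrFun h v
  · ext e
    by_cases h : e ∈ G.edgeSet
    · simp [h]
    · simp [h, x.2.1 e h]
  · ext e
    simp

theorem boundaryMatrix_transpose_mulVec {u w : V} (h : G.Adj u w) (x : V → ZMod 2) :
    (G.boundaryMatrix.transpose.mulVec x) ⟨s(u, w), h⟩ = x u + x w := by
  have hs : (Finset.univ.filter fun v => v = u ∨ v = w) = {u, w} := by ext; simp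
  simp [Matrix.mulVec, dotProduct, boundaryMatrix, ← Finset.sum_filter, hs,
    Finset.sum_pair h.ne]

theorem Connected.ker_transpose_boundaryMatrix (hconn : G.Connected) :
    LinearMap.ker G.boundaryMatrix.transpose.mulVecLin = Submodule.span (ZMod 2) {1} := by
  ext x
  rw [Submodule.mem_span_singleton, LinearMap.mem_ker, Matrix.mulVecLin_apply]
  constructor
  · intro hx
    have hadj (u w) (h : G.Adj u w) : x u = x w := by
      have := congrFun hx ⟨s(u, w), h⟩
      rw [boundaryMatrix_transpose_mulVec] at this
      exact CharTwo.add_eq_zero.1 this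
    have hwalk (u w) (p : G.Walk u w) : x u = x w := by
      induction p with
      | nil => rfl
      | cons h _ ih => exact (hadj _ _ h).trans ih
    obtain ⟨u⟩ := hconn.nonempty
    refine ⟨x u, funext fun w => ?_⟩
    obtain ⟨p⟩ := hconn.preconnected u w
    simpa using hwalk u w p
  · rintro ⟨c, rfl⟩
    ext ⟨e, he⟩
    induction e with
    | _ u w => rw [boundaryMatrix_transpose_mulVec he]; exact CharTwo.add_self_eq_zero _

theorem Connected.finrank_cycleSpace_add_card [DecidableRel G.Adj] (hconn : G.Connected) :
    Module.finrank (ZMod 2) G.cycleSpace + Fintype.card V = G.edgeFinset.card + 1 := by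
  have := hconn.nonempty
  have h1 := G.boundaryMatrix.mulVecLin.finrank_range_add_finrank_ker
  have h2 := G.boundaryMatrix.transpose.mulVecLin.finrank_range_add_finrank_ker
  have h3 := G.boundaryMatrix.rank_transpose
  rw [hconn.ker_transpose_boundaryMatrix, finrank_span_singleton one_ne_zero,
    Module.finrank_fintype_fun_eq_card] at h2
  rw [Module.finrank_fintype_fun_eq_card, ← edgeFinset_card] at h1
  rw [finrank_cycleSpace_eq_finrank_ker]
  unfold Matrix.rank at h3
  omega

theorem isOneCycle_iff_mem_cycleSpace {C : Finset (Sym2 V)} :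
    IsOneCycle G C ↔ (fun e => if e ∈ C then 1 else 0) ∈ G.cycleSpace := by
  rw [mem_cycleSpace, IsOneCycle]
  refine and_congr ⟨fun h e he => if_neg fun hC => he (h e hC), fun h e he => ?_⟩
    (forall_congr' fun v => ?_)
  · by_contra hne
    simpa [he] using h e hne
  · rw [Finset.sum_boole, ZMod.natCast_eq_zero_iff_even, Finset.filter_filter]
    have : C.filter (fun e => v ∈ e) = Finset.univ.filter fun e => v ∈ e ∧ e ∈ C := by
      ext; simp [and_comm]
    rw [this]

end SimpleGraph

/-- Subsets of `n × n` correspond to matrices over `ZMod 2`. -/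
def Finset.equivMatrixZModTwo (n : Type*) [Fintype n] [DecidableEq n] :
    Finset (n × n) ≃ Matrix n n (ZMod 2) where
  toFun C := Matrix.of fun i j => if (i, j) ∈ C then 1 else 0
  invFun A := Finset.univ.filter fun p => A p.1 p.2 = 1
  left_inv C := by ext; simp
  right_inv A := by
    ext i j
    have : ∀ a : ZMod 2, (if a = 1 then (1 : ZMod 2) else 0) = a := by decide
    simp [this]

theorem isCellular2Cycle_symmetric_iff {V : Type*} [Fintype V] [DecidableEq V]
    (G : SimpleGraph V) (C : Finset (Sym2 V × Sym2 V)) :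
    (IsCellular2Cycle G C ∧ ∀ p ∈ C, (p.2, p.1) ∈ C) ↔
      (Finset.equivMatrixZModTwo _ C).IsSymm ∧
        ∀ j, (Finset.equivMatrixZModTwo _ C).col j ∈ G.cycleSpace := by
  have hcol (j) : (Finset.equivMatrixZModTwo _ C).col j ∈ G.cycleSpace ↔
      IsOneCycle G ((C.filter (fun p => p.2 = j)).image Prod.fst) := by
    rw [SimpleGraph.isOneCycle_iff_mem_cycleSpace]
    convert Iff.rfl using 2
    ext i
    simp [Finset.equivMatrixZModTwo]
  have hsymm : (Finset.equivMatrixZModTwo _ C).IsSymm ↔ ∀ p ∈ C, (p.2, p.1) ∈ C := by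
    rw [Matrix.IsSymm.ext_iff]
    constructor
    · intro h p hp
      by_contra hn
      simpa [Finset.equivMatrixZModTwo, hp, hn] using h p.1 p.2
    · intro h i j
      have : (j, i) ∈ C ↔ (i, j) ∈ C := ⟨h (j, i), h (i, j)⟩
      simp [Finset.equivMatrixZModTwo, this]
  simp only [hcol, hsymm]
  constructor
  · rintro ⟨⟨-, h⟩, hs⟩
    exact ⟨hs, fun j => (h j).2⟩
  · rintro ⟨hs, h⟩
    refine ⟨⟨fun p hp => ⟨(h p.2).1 _ ?_, (h p.1).1 _ ?_⟩, fun σ => ⟨?_, h σ⟩⟩, hs⟩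
    · simpa using hp
    · simpa using hs p hp
    · convert h σ using 1
      ext e
      simpa using ⟨hs (σ, e), hs (e, σ)⟩

/-- For a finite connected simple graph `K` with `V` vertices and `E` edges and
`q = E - V + 1`, the number of symmetric cellular 2-cycles in `K²` equals
`2 ^ (q(q+1)/2)`. -/
theorem card_symmetric_cellular2Cycles {V : Type*} [Fintype V] [DecidableEq V]
    (G : SimpleGraph V) [DecidableRel G.Adj] (hconn : G.Connected)
    (q : ℕ) (hq : q = G.edgeFinset.card + 1 - Fintype.card V) :
    Nat.card {C : Finset (Sym2 V × Sym2 V) // IsCellular2Cycle G C ∧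
        ∀ p ∈ C, (p.2, p.1) ∈ C}
      = 2 ^ (q * (q + 1) / 2) := by
  have hrank : Module.finrank (ZMod 2) G.cycleSpace = q := by
    have := hconn.finrank_cycleSpace_add_card
    omega
  let e := (Finset.equivMatrixZModTwo (Sym2 V)).subtypeEquiv
    (q := fun A => A.IsSymm ∧ ∀ j, A.col j ∈ G.cycleSpace) (isCellular2Cycle_symmetric_iff G)
  rw [Nat.card_congr e, Matrix.card_isSymm_col_mem, hrank, ZMod.card, Nat.choose_two_right,
    Nat.add_sub_cancel, mul_comm]
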